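/- Interchangeability of optimal policies for histories with equal statistic: in a finite partially observed model equipped with a sufficient statistic (B, b_t, φ, ρ, ω), let o, o' ∈ O_t be reachable with b_t(o) = b_t(o'). Then for every continuation string σ ∈ (U × Z)^k with t + k ≤ ℓ: the extended history o ++ σ is reachable if and only if o' ++ σ is reachable, and when both are reachable and t + k < ℓ, Q*_{t+k}(o ++ σ, u) = Q*_{t+k}(o' ++ σ, u) for every u ∈ U; in particular argmax_{u∈U} Q*_{t+k}(o ++ σ, u) = argmax_{u∈U} Q*_{t+k}(o' ++ σ, u), so any optimal continuation policy for o is also optimal for o' and vice versa. -/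

import Mathlib

open scoped Classical

namespace DecPOMDP

variable {X U Z : Type}

/-- Auxiliary filter, recursing on the (reversed) history. -/
noncomputable def filtAux [Fintype X] (s0 : X → ℝ) (p : X → U → X → Z → ℝ) :
    List (U × Z) → X → ℝ
  | [], x => s0 x
  | uz :: rest, y => ∑ x, filtAux s0 p rest x * p x uz.1 y uz.2

/-- The policy-independent unnormalized filter `μ`:
`filt s0 p [] = s0` and `filt s0 p (o ++ [(u,z)]) y = ∑ x, filt s0 p o x * p x u y z`. -/
noncomputable def filt [Fintype X] (s0 : X → ℝ) (p : X → U → X → Z → ℝ)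
    (o : List (U × Z)) (x : X) : ℝ :=
  filtAux s0 p o.reverse x

/-- A history is reachable if its total filter mass is positive. -/
def reachable [Fintype X] (s0 : X → ℝ) (p : X → U → X → Z → ℝ)
    (o : List (U × Z)) : Prop :=
  0 < ∑ x, filt s0 p o x

/-- The belief (normalized filter) of a history. -/
noncomputable def bel [Fintype X] (s0 : X → ℝ) (p : X → U → X → Z → ℝ)
    (o : List (U × Z)) (x : X) : ℝ :=
  filt s0 p o x / ∑ x', filt s0 p o x'

/-- Optimal history value with `k` stages to go: `Vstar s0 p r γ (ℓ - t)` is `V*_t`. -/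
noncomputable def Vstar [Fintype X] [Fintype U] [Fintype Z] [Nonempty U]
    (s0 : X → ℝ) (p : X → U → X → Z → ℝ) (r : X → U → ℝ) (γ : ℝ) :
    ℕ → List (U × Z) → ℝ
  | 0, _ => 0
  | k + 1, o =>
    Finset.univ.sup' Finset.univ_nonempty fun u : U =>
      (∑ x, bel s0 p o x * r x u) +
        γ * ∑ z : Z,
          if reachable s0 p (o ++ [(u, z)]) then
            (∑ x, ∑ y, bel s0 p o x * p x u y z) * Vstar s0 p r γ k (o ++ [(u, z)])
          else 0

/-- Optimal history action-value: `Qstar s0 p r γ (ℓ - t - 1)` is `Q*_t` (for `t < ℓ`). -/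
noncomputable def Qstar [Fintype X] [Fintype U] [Fintype Z] [Nonempty U]
    (s0 : X → ℝ) (p : X → U → X → Z → ℝ) (r : X → U → ℝ) (γ : ℝ)
    (k : ℕ) (o : List (U × Z)) (u : U) : ℝ :=
  (∑ x, bel s0 p o x * r x u) +
    γ * ∑ z : Z,
      if reachable s0 p (o ++ [(u, z)]) then
        (∑ x, ∑ y, bel s0 p o x * p x u y z) * Vstar s0 p r γ k (o ++ [(u, z)])
      else 0

/-- The history generated up to stage `t` by policy `π` along observation stream `z`
(`z t` being the observation received at stage `t+1`). -/
def hist (π : List (U × Z) → U) (z : ℕ → Z) : ℕ → List (U × Z)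
  | 0 => []
  | t + 1 => hist π z t ++ [(π (hist π z t), z t)]

/-- Extend a finitely indexed stream to `ℕ` (junk beyond `m`). -/
noncomputable def extend {α : Type} [Nonempty α] (m : ℕ) (f : Fin m → α) (t : ℕ) : α :=
  if h : t < m then f ⟨t, h⟩ else Classical.arbitrary α

/-- Expected discounted return `J(π)`: a finite sum over trajectories
`(x_0, …, x_ℓ, z_1, …, z_ℓ)` of the trajectory probability times the discounted return,
actions being chosen by `π` on the generated histories. -/
noncomputable def Jret [Fintype X] [Fintype U] [Fintype Z] [Nonempty X] [Nonempty Z]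
    (s0 : X → ℝ) (p : X → U → X → Z → ℝ) (r : X → U → ℝ) (γ : ℝ) (ℓ : ℕ)
    (π : List (U × Z) → U) : ℝ :=
  ∑ x : Fin (ℓ + 1) → X, ∑ z : Fin ℓ → Z,
    (s0 (extend (ℓ + 1) x 0) *
        ∏ t ∈ Finset.range ℓ,
          p (extend (ℓ + 1) x t) (π (hist π (extend ℓ z) t))
            (extend (ℓ + 1) x (t + 1)) (extend ℓ z t)) *
      ∑ t ∈ Finset.range ℓ, γ ^ t * r (extend (ℓ + 1) x t) (π (hist π (extend ℓ z) t))

/-- `Pr_π(o_t = o ∧ x_t = xh)`: a finite sum over partial trajectories. -/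
noncomputable def PrHS [Fintype X] [Fintype U] [Fintype Z] [Nonempty X] [Nonempty Z]
    (s0 : X → ℝ) (p : X → U → X → Z → ℝ) (π : List (U × Z) → U)
    (t : ℕ) (o : List (U × Z)) (xh : X) : ℝ :=
  ∑ x : Fin (t + 1) → X, ∑ z : Fin t → Z,
    if hist π (extend t z) t = o ∧ extend (t + 1) x t = xh then
      s0 (extend (t + 1) x 0) *
        ∏ s ∈ Finset.range t,
          p (extend (t + 1) x s) (π (hist π (extend t z) s))
            (extend (t + 1) x (s + 1)) (extend t z s)
    else 0

/-- `Pr_π(o_t = o)`. -/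
noncomputable def PrH [Fintype X] [Fintype U] [Fintype Z] [Nonempty X] [Nonempty Z]
    (s0 : X → ℝ) (p : X → U → X → Z → ℝ) (π : List (U × Z) → U)
    (t : ℕ) (o : List (U × Z)) : ℝ :=
  ∑ xh, PrHS s0 p π t o xh

end DecPOMDP

namespace DecPOMDP

section Filter

variable {X U Z : Type} [Fintype X] {s0 : X → ℝ} {p : X → U → X → Z → ℝ}

theorem filt_append_singleton (o : List (U × Z)) (a : U × Z) (y : X) :
    filt s0 p (o ++ [a]) y = ∑ x, filt s0 p o x * p x a.1 y a.2 := by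
  simp [filt, filtAux]

theorem filt_nonneg (hs0 : ∀ x, 0 ≤ s0 x) (hp : ∀ x u y z, 0 ≤ p x u y z)
    (o : List (U × Z)) (x : X) : 0 ≤ filt s0 p o x := by
  induction o using List.reverseRecOn generalizing x with
  | nil => exact hs0 x
  | append_singleton o a ih =>
    rw [filt_append_singleton]
    exact Finset.sum_nonneg fun x' _ => mul_nonneg (ih x') (hp _ _ _ _)

theorem reachable_of_append_singleton (hs0 : ∀ x, 0 ≤ s0 x) (hp : ∀ x u y z, 0 ≤ p x u y z)
    {o : List (U × Z)} {a : U × Z} (h : reachable s0 p (o ++ [a])) : reachable s0 p o := by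
  have hnn := filt_nonneg hs0 hp o
  refine (Finset.sum_nonneg fun x _ => hnn x).lt_of_ne fun h0 => ?_
  have hz : ∀ x, filt s0 p o x = 0 := fun x =>
    (Finset.sum_eq_zero_iff_of_nonneg fun x _ => hnn x).1 h0.symm x (Finset.mem_univ x)
  simp [reachable, filt_append_singleton, hz] at h

theorem reachable_append_singleton_iff {o : List (U × Z)} (ho : reachable s0 p o)
    (u : U) (z : Z) :
    reachable s0 p (o ++ [(u, z)]) ↔ 0 < ∑ x, ∑ y, bel s0 p o x * p x u y z := by
  have hmass : ∑ x, ∑ y, bel s0 p o x * p x u y z =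
      (∑ y, filt s0 p (o ++ [(u, z)]) y) / ∑ x, filt s0 p o x := by
    simp only [bel, filt_append_singleton]
    rw [Finset.sum_comm]
    simp only [Finset.sum_div, div_mul_eq_mul_div]
  rw [hmass, reachable, div_pos_iff_of_pos_right ho]

end Filter

section SufficientStatistic

variable {X U Z B : Type} [Fintype X] {s0 : X → ℝ} {p : X → U → X → Z → ℝ} {ℓ : ℕ}
  {bstat : List (U × Z) → B} {φ : B → U → Z → B} {ρ : B → U → ℝ} {ω : B → U → Z → ℝ}

theorem reachable_append_singleton_congr
    (hω : ∀ o : List (U × Z), o.length < ℓ → reachable s0 p o →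
      ∀ u z, ∑ x, ∑ y, bel s0 p o x * p x u y z = ω (bstat o) u z)
    {o o' : List (U × Z)} (hl : o.length < ℓ) (hl' : o'.length < ℓ)
    (ho : reachable s0 p o) (ho' : reachable s0 p o') (hb : bstat o = bstat o')
    (u : U) (z : Z) :
    reachable s0 p (o ++ [(u, z)]) ↔ reachable s0 p (o' ++ [(u, z)]) := by
  rw [reachable_append_singleton_iff ho, reachable_append_singleton_iff ho',
    hω o hl ho, hω o' hl' ho', hb]

theorem reachable_append_congr (hs0 : ∀ x, 0 ≤ s0 x) (hp : ∀ x u y z, 0 ≤ p x u y z)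
    (hω : ∀ o : List (U × Z), o.length < ℓ → reachable s0 p o →
      ∀ u z, ∑ x, ∑ y, bel s0 p o x * p x u y z = ω (bstat o) u z)
    (hφ : ∀ o : List (U × Z), o.length < ℓ → reachable s0 p o →
      ∀ u z, reachable s0 p (o ++ [(u, z)]) → bstat (o ++ [(u, z)]) = φ (bstat o) u z)
    {o o' : List (U × Z)} (ho : reachable s0 p o) (ho' : reachable s0 p o')
    (hb : bstat o = bstat o') (σ : List (U × Z))
    (hl : o.length + σ.length ≤ ℓ) (hl' : o'.length + σ.length ≤ ℓ) :
    (reachable s0 p (o ++ σ) ↔ reachable s0 p (o' ++ σ)) ∧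
      (reachable s0 p (o ++ σ) → bstat (o ++ σ) = bstat (o' ++ σ)) := by
  induction σ using List.reverseRecOn with
  | nil => simp [ho, ho', hb]
  | append_singleton σ a ih =>
    obtain ⟨u, z⟩ := a
    simp only [List.length_append, List.length_singleton] at hl hl'
    obtain ⟨hiff, hstat⟩ := ih (by omega) (by omega)
    have hlσ : (o ++ σ).length < ℓ := by rw [List.length_append]; omega
    have hlσ' : (o' ++ σ).length < ℓ := by rw [List.length_append]; omega
    rw [← List.append_assoc, ← List.append_assoc]
    by_cases hr : reachable s0 p (o ++ σ)
    · have hr' := hiff.1 hr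
      have hstep := reachable_append_singleton_congr hω hlσ hlσ' hr hr' (hstat hr) u z
      refine ⟨hstep, fun h => ?_⟩
      rw [hφ _ hlσ hr u z h, hφ _ hlσ' hr' u z (hstep.1 h), hstat hr]
    · have hn : ¬ reachable s0 p (o ++ σ ++ [(u, z)]) :=
        mt (reachable_of_append_singleton hs0 hp) hr
      have hn' : ¬ reachable s0 p (o' ++ σ ++ [(u, z)]) :=
        mt (reachable_of_append_singleton hs0 hp) (mt hiff.2 hr)
      exact ⟨iff_of_false hn hn', fun h => absurd h hn⟩

variable [Fintype U] [Fintype Z] [Nonempty U] {r : X → U → ℝ} {γ : ℝ}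

theorem Vstar_succ (k : ℕ) (o : List (U × Z)) :
    Vstar s0 p r γ (k + 1) o =
      Finset.univ.sup' Finset.univ_nonempty (Qstar s0 p r γ k o) :=
  rfl

/-- The optimal action-values depend on a reachable history only through its statistic. -/
theorem Qstar_congr
    (hρ : ∀ o : List (U × Z), o.length < ℓ → reachable s0 p o →
      ∀ u, ∑ x, bel s0 p o x * r x u = ρ (bstat o) u)
    (hω : ∀ o : List (U × Z), o.length < ℓ → reachable s0 p o →
      ∀ u z, ∑ x, ∑ y, bel s0 p o x * p x u y z = ω (bstat o) u z)
    (hφ : ∀ o : List (U × Z), o.length < ℓ → reachable s0 p o →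
      ∀ u z, reachable s0 p (o ++ [(u, z)]) → bstat (o ++ [(u, z)]) = φ (bstat o) u z)
    {k : ℕ} {o o' : List (U × Z)} (hl : o.length + k < ℓ) (hl' : o'.length + k < ℓ)
    (ho : reachable s0 p o) (ho' : reachable s0 p o') (hb : bstat o = bstat o') :
    Qstar s0 p r γ k o = Qstar s0 p r γ k o' := by
  induction k generalizing o o' with
  | zero =>
    funext u
    simp [Qstar, Vstar, hρ o hl ho, hρ o' hl' ho', hb]
  | succ k ih =>
    have hlo : o.length < ℓ := by omega
    have hlo' : o'.length < ℓ := by omega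
    funext u
    simp only [Qstar, hρ o hlo ho, hρ o' hlo' ho', hω o hlo ho, hω o' hlo' ho', hb]
    congr 2
    refine Finset.sum_congr rfl fun z _ => ?_
    have hstep := reachable_append_singleton_congr hω hlo hlo' ho ho' hb u z
    by_cases hr : reachable s0 p (o ++ [(u, z)])
    · have hr' := hstep.1 hr
      rw [if_pos hr, if_pos hr', Vstar_succ, Vstar_succ,
        ih (by simp; omega) (by simp; omega) hr hr'
          (by rw [hφ o hlo ho u z hr, hφ o' hlo' ho' u z hr', hb])]
    · rw [if_neg hr, if_neg (mt hstep.2 hr)]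

end SufficientStatistic

end DecPOMDP

open DecPOMDP in
/-- Interchangeability of optimal policies for histories with equal statistic:
if `o, o' ∈ O_t` are reachable with `b_t o = b_t o'`, then for every continuation
string `σ` with `t + |σ| ≤ ℓ`: `o ++ σ` is reachable iff `o' ++ σ` is, and when both
are reachable and `t + |σ| < ℓ`, the optimal action-values `Q*_{t+|σ|}` at `o ++ σ`
and `o' ++ σ` agree for every action; in particular their argmax sets coincide. -/
theorem stmt5 (X U Z : Type) [Fintype X] [Nonempty X] [Fintype U] [Nonempty U]
    [Fintype Z] [Nonempty Z]
    (s0 : X → ℝ) (hs0 : ∀ x, 0 ≤ s0 x) (hs0sum : ∑ x, s0 x = 1)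
    (p : X → U → X → Z → ℝ) (hp : ∀ x u y z, 0 ≤ p x u y z)
    (hpsum : ∀ x u, ∑ y, ∑ z, p x u y z = 1)
    (r : X → U → ℝ) (γ : ℝ) (hγ0 : 0 ≤ γ) (hγ1 : γ ≤ 1) (ℓ : ℕ)
    (B : Type) (bstat : List (U × Z) → B)
    (φ : B → U → Z → B) (ρ : B → U → ℝ) (ω : B → U → Z → ℝ)
    (hρ : ∀ o : List (U × Z), o.length < ℓ → reachable s0 p o →
      ∀ u, ∑ x, bel s0 p o x * r x u = ρ (bstat o) u)
    (hω : ∀ o : List (U × Z), o.length < ℓ → reachable s0 p o →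
      ∀ u z, ∑ x, ∑ y, bel s0 p o x * p x u y z = ω (bstat o) u z)
    (hφ : ∀ o : List (U × Z), o.length < ℓ → reachable s0 p o →
      ∀ u z, reachable s0 p (o ++ [(u, z)]) →
        bstat (o ++ [(u, z)]) = φ (bstat o) u z)
    (t : ℕ) (ht : t ≤ ℓ) (o o' : List (U × Z))
    (hlen : o.length = t) (hlen' : o'.length = t)
    (hro : reachable s0 p o) (hro' : reachable s0 p o')
    (hb : bstat o = bstat o') :
    ∀ σ : List (U × Z), t + σ.length ≤ ℓ →
      (reachable s0 p (o ++ σ) ↔ reachable s0 p (o' ++ σ)) ∧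
      (t + σ.length < ℓ → reachable s0 p (o ++ σ) → reachable s0 p (o' ++ σ) →
        (∀ u, Qstar s0 p r γ (ℓ - (t + σ.length) - 1) (o ++ σ) u =
            Qstar s0 p r γ (ℓ - (t + σ.length) - 1) (o' ++ σ) u) ∧
        {u : U | ∀ u', Qstar s0 p r γ (ℓ - (t + σ.length) - 1) (o ++ σ) u' ≤
            Qstar s0 p r γ (ℓ - (t + σ.length) - 1) (o ++ σ) u} =
          {u : U | ∀ u', Qstar s0 p r γ (ℓ - (t + σ.length) - 1) (o' ++ σ) u' ≤
            Qstar s0 p r γ (ℓ - (t + σ.length) - 1) (o' ++ σ) u}) := by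
  intro σ hσ
  obtain ⟨hiff, hstat⟩ :=
    reachable_append_congr hs0 hp hω hφ hro hro' hb σ (by omega) (by omega)
  refine ⟨hiff, fun hlt hr hr' => ?_⟩
  have hQ : Qstar s0 p r γ (ℓ - (t + σ.length) - 1) (o ++ σ) =
      Qstar s0 p r γ (ℓ - (t + σ.length) - 1) (o' ++ σ) :=
    Qstar_congr hρ hω hφ (by rw [List.length_append]; omega)
      (by rw [List.length_append]; omega) hr hr' (hstat hr)
  exact ⟨congrFun hQ, by rw [hQ]⟩
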